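/- arXiv:1504.08138 — 2 statements merged into one kernel-verified Lean document; each statement's English description precedes it below -/
import Mathlib

section
/- (Shuffle product for bi-brackets in length one.) For all integers s₁, s₂ ≥ 1 and r₁, r₂ ≥ 0 we have, in ℚ[[q]]: [s₁; r₁] · [s₂; r₂] = Σ_{1 ≤ j ≤ s₁} Σ_{0 ≤ k ≤ r₂} C(s₁+s₂−j−1, s₁−j) · C(r₁+r₂−k, r₁) · (−1)^{r₂−k} · [s₁+s₂−j, j; k, r₁+r₂−k] + Σ_{1 ≤ j ≤ s₂} Σ_{0 ≤ k ≤ r₁} C(s₁+s₂−j−1, s₁−1) · C(r₁+r₂−k, r₁−k) · (−1)^{r₁−k} · [s₁+s₂−j, j; k, r₁+r₂−k] + C(s₁+s₂−2, s₁−1) · [s₁+s₂−1; r₁+r₂+1] + C(s₁+s₂−2, s₁−1) · Σ_{j=0}^{r₁} (−1)^{r₂} · (B_{r₁+r₂−j+1}/(r₁+r₂−j+1)!) · C(r₁+r₂−j, r₁−j) · [s₁+s₂−1; j] + C(s₁+s₂−2, s₁−1) · Σ_{j=0}^{r₂} (−1)^{r₁} · (B_{r₁+r₂−j+1}/(r₁+r₂−j+1)!)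 · C(r₁+r₂−j, r₂−j) · [s₁+s₂−1; j], where C(a,b) is the binomial coefficient. -/
open scoped Nat

/-- The bi-bracket `[s₁,…,sₗ; r₁,…,rₗ]`: the formal power series in `ℚ[[q]]` whose
coefficient of `qⁿ` is the sum of `∏ⱼ (uⱼ^{rⱼ}/rⱼ!)·(vⱼ^{sⱼ−1}/(sⱼ−1)!)` over all
tuples `u₁ > … > uₗ > 0`, `v₁,…,vₗ > 0` with `u₁v₁ + … + uₗvₗ = n`. -/
noncomputable def biBracket (l : ℕ) (s r : Fin l → ℕ) : PowerSeries ℚ :=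
  PowerSeries.mk fun n =>
    ∑ᶠ uv ∈ {uv : (Fin l → ℕ) × (Fin l → ℕ) |
        StrictAnti uv.1 ∧ (∀ j, 0 < uv.1 j) ∧ (∀ j, 0 < uv.2 j) ∧
        (∑ j, uv.1 j * uv.2 j) = n},
      ∏ j, ((uv.1 j : ℚ) ^ r j / (r j)!) * ((uv.2 j : ℚ) ^ (s j - 1) / ((s j - 1)!))

/-- The divided power `xⁿ / n!`. -/
def dividedPow (n : ℕ) (x : ℚ) : ℚ := x ^ n / (n ! : ℚ)

lemma mul_dividedPow (n : ℕ) (x : ℚ) :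
    x * dividedPow n x = (n + 1) * dividedPow (n + 1) x := by
  have h : ((n : ℚ) + 1) ≠ 0 := by positivity
  have h' : (n ! : ℚ) ≠ 0 := by positivity
  simp only [dividedPow, Nat.factorial_succ, pow_succ]
  push_cast
  field_simp

lemma dividedPow_mul_dividedPow (a b : ℕ) (x : ℚ) :
    dividedPow a x * dividedPow b x = ((a + b).choose a : ℚ) * dividedPow (a + b) x := by
  have h := Nat.add_choose_mul_factorial_mul_factorial a b
  have h1 : (a ! : ℚ) ≠ 0 := by positivity
  have h2 : (b ! : ℚ) ≠ 0 := by positivity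
  have h3 : ((a + b)! : ℚ) ≠ 0 := by positivity
  have h' : ((a + b).choose a : ℚ) * a ! * b ! = (a + b)! := by
    rw [Nat.choose_symm_add]
    exact_mod_cast h
  simp only [dividedPow, pow_add]
  field_simp
  linear_combination -(x ^ a * x ^ b) * h'

lemma dividedPow_neg (n : ℕ) (x : ℚ) :
    dividedPow n (-x) = (-1) ^ n * dividedPow n x := by
  simp only [dividedPow]
  rw [neg_pow]
  ring

lemma dividedPow_add (n : ℕ) (x y : ℚ) :
    dividedPow n (x + y) =
      ∑ k ∈ Finset.range (n + 1), dividedPow k x * dividedPow (n - k) y := by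
  simp only [dividedPow]
  rw [add_pow, Finset.sum_div]
  refine Finset.sum_congr rfl fun k hk => ?_
  have hk : k ≤ n := by simpa [Nat.lt_succ_iff] using hk
  rw [Nat.cast_choose ℚ hk]
  have h3 : (n ! : ℚ) ≠ 0 := by positivity
  field_simp

lemma dividedPow_add_mul (a b : ℕ) (x v : ℚ) :
    dividedPow a (x + v) * dividedPow b v =
      ∑ k ∈ Finset.range (a + 1), ((a + b - k).choose (a - k) : ℚ) *
        (dividedPow (a + b - k) v * dividedPow k x) := by
  rw [dividedPow_add, Finset.sum_mul]
  refine Finset.sum_congr rfl fun k hk => ?_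
  have hk : k ≤ a := by simpa [Nat.lt_succ_iff] using hk
  rw [mul_assoc, dividedPow_mul_dividedPow, show a - k + b = a + b - k by omega]
  ring

lemma dividedPow_mul_sub (a b : ℕ) (w u : ℚ) :
    dividedPow a w * dividedPow b (u - w) =
      ∑ k ∈ Finset.range (b + 1), (((a + b - k).choose a : ℚ) * (-1) ^ (b - k)) *
        (dividedPow k u * dividedPow (a + b - k) w) := by
  rw [sub_eq_add_neg, dividedPow_add, Finset.mul_sum]
  refine Finset.sum_congr rfl fun k hk => ?_
  have hk : k ≤ b := by simpa [Nat.lt_succ_iff] using hk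
  have h := dividedPow_mul_dividedPow a (b - k) w
  rw [show a + (b - k) = a + b - k by omega] at h
  rw [dividedPow_neg]
  linear_combination dividedPow k u * (-1) ^ (b - k) * h

/-- The polynomial in `u` collecting the Bernoulli terms of one of the two halves of
`∑_{0 < w < u} (w^a / a!) ((u - w)^b / b!)`. -/
def bernoulliPart (a b : ℕ) (u : ℚ) : ℚ :=
  ∑ j ∈ Finset.range (a + 1),
    ((-1 : ℚ) ^ b * (bernoulli (a + b - j + 1) / ((a + b - j + 1)! : ℚ)) *
      ((a + b - j).choose (a - j) : ℚ)) * dividedPow j u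

lemma mul_bernoulliPart (a b : ℕ) (u : ℚ) :
    u * bernoulliPart a b u =
      (a + 1) * bernoulliPart (a + 1) b u + (b + 1) * bernoulliPart a (b + 1) u := by
  have key : ∀ m j : ℕ, m = a + b + 1 - j → j ≤ a + 1 →
      (j : ℚ) * (m.choose b : ℚ) = (a + 1) * (m.choose b : ℚ) - (b + 1) * (m.choose (b + 1)) := by
    rintro m j rfl hj
    have h := Nat.choose_succ_right_eq (a + b + 1 - j) b
    have h' : ((a + b + 1 - j).choose (b + 1) : ℚ) * (b + 1) =
        (a + b + 1 - j).choose b * (a + 1 - j) := by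
      rw [show a + b + 1 - j - b = a + 1 - j by omega] at h
      have := congrArg (Nat.cast : ℕ → ℚ) h
      rw [Nat.cast_mul, Nat.cast_mul, Nat.cast_sub hj] at this
      exact_mod_cast this
    linear_combination h'
  have e1 : u * bernoulliPart a b u = ∑ j ∈ Finset.range (a + 2),
      ((-1 : ℚ) ^ b * (bernoulli (a + b + 1 - j + 1) / ((a + b + 1 - j + 1)! : ℚ)) *
        (j * ((a + b + 1 - j).choose b : ℚ))) * dividedPow j u := by
    rw [Finset.sum_range_succ', bernoulliPart, Finset.mul_sum]
    simp only [Nat.cast_zero, zero_mul, mul_zero, add_zero]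
    refine Finset.sum_congr rfl fun j hj => ?_
    have hj : j ≤ a := by simpa [Nat.lt_succ_iff] using hj
    have h := mul_dividedPow j u
    rw [show a + b + 1 - (j + 1) = a + b - j by omega,
      ← Nat.choose_symm_of_eq_add (show a + b - j = (a - j) + b by omega)]
    push_cast
    linear_combination ((-1 : ℚ) ^ b * (bernoulli (a + b - j + 1) / ((a + b - j + 1)! : ℚ)) *
      ((a + b - j).choose (a - j) : ℚ)) * h
  have e2 : bernoulliPart (a + 1) b u = ∑ j ∈ Finset.range (a + 2),
      ((-1 : ℚ) ^ b * (bernoulli (a + b + 1 - j + 1) / ((a + b + 1 - j + 1)! : ℚ)) *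
        ((a + b + 1 - j).choose b : ℚ)) * dividedPow j u := by
    rw [bernoulliPart]
    refine Finset.sum_congr rfl fun j hj => ?_
    have hj : j < a + 2 := by simpa using hj
    rw [show a + 1 + b - j = a + b + 1 - j by omega,
      ← Nat.choose_symm_of_eq_add (show a + b + 1 - j = (a + 1 - j) + b by omega)]
  have e3 : bernoulliPart a (b + 1) u = ∑ j ∈ Finset.range (a + 2),
      (-(-1 : ℚ) ^ b * (bernoulli (a + b + 1 - j + 1) / ((a + b + 1 - j + 1)! : ℚ)) *
        ((a + b + 1 - j).choose (b + 1) : ℚ)) * dividedPow j u := by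
    rw [Finset.sum_range_succ, bernoulliPart, Nat.choose_eq_zero_of_lt (show _ < b + 1 by omega)]
    simp only [Nat.cast_zero, zero_mul, mul_zero, add_zero]
    refine Finset.sum_congr rfl fun j hj => ?_
    have hj : j ≤ a := by simpa [Nat.lt_succ_iff] using hj
    rw [show a + (b + 1) - j = a + b + 1 - j by omega,
      ← Nat.choose_symm_of_eq_add (show a + b + 1 - j = (a - j) + (b + 1) by omega)]
    ring
  rw [e1, e2, e3, Finset.mul_sum, Finset.mul_sum, ← Finset.sum_add_distrib]
  refine Finset.sum_congr rfl fun j hj => ?_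
  have hj : j < a + 2 := by simpa using hj
  linear_combination ((-1 : ℚ) ^ b * (bernoulli (a + b + 1 - j + 1) / ((a + b + 1 - j + 1)! : ℚ))) *
    dividedPow j u * key _ j rfl (by omega)

lemma sum_range_dividedPow (a u : ℕ) :
    ∑ w ∈ Finset.range u, dividedPow a w =
      dividedPow (a + 1) u + bernoulliPart a 0 u - bernoulli (a + 1) / ((a + 1)! : ℚ) := by
  have h : ∑ w ∈ Finset.range u, dividedPow a w =
      ∑ i ∈ Finset.range (a + 1), bernoulli i / (i ! : ℚ) * dividedPow (a + 1 - i) u := by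
    simp only [dividedPow]
    rw [← Finset.sum_div, sum_range_pow, Finset.sum_div]
    refine Finset.sum_congr rfl fun i hi => ?_
    have hi : i ≤ a + 1 := by have := Finset.mem_range.1 hi; omega
    rw [Nat.cast_choose ℚ hi, Nat.factorial_succ]
    have h1 : (a ! : ℚ) ≠ 0 := by positivity
    have h2 : (i ! : ℚ) ≠ 0 := by positivity
    have h3 : ((a + 1 - i)! : ℚ) ≠ 0 := by positivity
    have h4 : (a : ℚ) + 1 ≠ 0 := by positivity
    push_cast
    field_simp
  have h' : dividedPow (a + 1) u + bernoulliPart a 0 u = ∑ j ∈ Finset.range (a + 2),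
      bernoulli (a + 1 - j) / ((a + 1 - j)! : ℚ) * dividedPow j u := by
    rw [Finset.sum_range_succ, bernoulliPart, add_comm]
    congr 1
    · refine Finset.sum_congr rfl fun j hj => ?_
      have hj : j ≤ a := by simpa [Nat.lt_succ_iff] using hj
      rw [show a + 0 - j + 1 = a + 1 - j by omega, add_zero, Nat.choose_self]
      simp
    · simp
  rw [h, h', ← Finset.sum_range_reflect (n := a + 2), Finset.sum_range_succ (n := a + 1)]
  have hrefl : ∀ i ∈ Finset.range (a + 1),
      bernoulli (a + 1 - (a + 2 - 1 - i)) / ((a + 1 - (a + 2 - 1 - i))! : ℚ) *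
        dividedPow (a + 2 - 1 - i) u =
      bernoulli i / (i ! : ℚ) * dividedPow (a + 1 - i) u := by
    intro i hi
    have hi : i < a + 1 := Finset.mem_range.1 hi
    rw [show a + 2 - 1 - i = a + 1 - i by omega, show a + 1 - (a + 1 - i) = i by omega]
  rw [Finset.sum_congr rfl hrefl]
  simp [dividedPow]

lemma bernoulli_add_neg_one_pow_mul (a : ℕ) :
    bernoulli (a + 1) + (-1) ^ a * bernoulli (a + 1) = if a = 0 then -1 else 0 := by
  rcases Nat.even_or_odd a with ha | ha
  · split_ifs with h0
    · subst h0; norm_num [bernoulli_one]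
    · rw [bernoulli_eq_zero_of_odd ha.add_one (by omega)]; simp
  · rw [if_neg (by rintro rfl; simp at ha), ha.neg_one_pow]; ring

/-- Summation formula for `∑_{0 < w < u} (w^a / a!) ((u - w)^b / b!)`. -/
lemma sum_Ico_dividedPow_mul (a b u : ℕ) (hu : 1 ≤ u) :
    ∑ w ∈ Finset.Ico 1 u, dividedPow a w * dividedPow b ((u : ℚ) - w) =
      dividedPow (a + b + 1) u + bernoulliPart a b u + bernoulliPart b a u := by
  induction b generalizing a with
  | zero =>
    have h := sum_range_dividedPow a u
    rw [Finset.range_eq_Ico, Finset.sum_eq_sum_Ico_succ_bot (by omega)] at h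
    have h0 : dividedPow a ((0 : ℕ) : ℚ) = if a = 0 then 1 else 0 := by
      split_ifs with h0
      · simp [h0, dividedPow]
      · simp [h0, dividedPow]
    have h1 : bernoulliPart 0 a u = (-1) ^ a * bernoulli (a + 1) / ((a + 1)! : ℚ) := by
      simp [bernoulliPart, dividedPow, mul_div_assoc]
    have h2 : (bernoulli (a + 1) + (-1) ^ a * bernoulli (a + 1)) / ((a + 1)! : ℚ) =
        if a = 0 then -1 else 0 := by
      rw [bernoulli_add_neg_one_pow_mul]
      split_ifs with h0 <;> simp [h0]
    have h3 : ∀ w : ℕ, dividedPow a w * dividedPow 0 ((u : ℚ) - w) = dividedPow a w := by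
      intro w; simp [dividedPow]
    simp only [h3, h1]
    rw [h0] at h
    rw [add_div] at h2
    simp only [zero_add, add_zero] at h ⊢
    split_ifs at h h2 <;> linear_combination h - h2
  | succ b ih =>
    have hb : (b : ℚ) + 1 ≠ 0 := by positivity
    refine mul_left_cancel₀ hb ?_
    have hL : ((b : ℚ) + 1) *
        ∑ w ∈ Finset.Ico 1 u, dividedPow a w * dividedPow (b + 1) ((u : ℚ) - w) =
        u * ∑ w ∈ Finset.Ico 1 u, dividedPow a w * dividedPow b ((u : ℚ) - w) -
        (a + 1) * ∑ w ∈ Finset.Ico 1 u, dividedPow (a + 1) w * dividedPow b ((u : ℚ) - w) := by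
      rw [Finset.mul_sum, Finset.mul_sum, Finset.mul_sum, ← Finset.sum_sub_distrib]
      refine Finset.sum_congr rfl fun w _ => ?_
      linear_combination -dividedPow a w * mul_dividedPow b ((u : ℚ) - w)
        - dividedPow b ((u : ℚ) - w) * mul_dividedPow a w
    rw [hL, ih a, ih (a + 1)]
    have h1 := mul_dividedPow (a + b + 1) u
    rw [show a + 1 + b + 1 = a + (b + 1) + 1 by ring]
    push_cast at h1
    rw [show a + b + 1 + 1 = a + (b + 1) + 1 by ring] at h1
    linear_combination h1 + mul_bernoulliPart a b u + mul_bernoulliPart b a u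

/-- Quadruples `((u₁, v₁), (u₂, v₂))` of positive integers with `u₁ v₁ + u₂ v₂ = n`. -/
def productPairs (n : ℕ) : Finset ((ℕ × ℕ) × (ℕ × ℕ)) :=
  (Finset.HasAntidiagonal.antidiagonal n).biUnion fun p =>
    p.1.divisorsAntidiagonal ×ˢ p.2.divisorsAntidiagonal

lemma mem_productPairs {n : ℕ} {x : (ℕ × ℕ) × (ℕ × ℕ)} :
    x ∈ productPairs n ↔ (0 < x.1.1 ∧ 0 < x.1.2) ∧ (0 < x.2.1 ∧ 0 < x.2.2) ∧
      x.1.1 * x.1.2 + x.2.1 * x.2.2 = n := by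
  simp only [productPairs, Finset.mem_biUnion, Finset.HasAntidiagonal.mem_antidiagonal,
    Finset.mem_product,
    Nat.mem_divisorsAntidiagonal, Prod.exists]
  constructor
  · rintro ⟨c, d, rfl, ⟨rfl, h1⟩, rfl, h2⟩
    simp only [ne_eq, mul_eq_zero, not_or] at h1 h2
    simp only [Nat.pos_iff_ne_zero]
    exact ⟨h1, h2, trivial⟩
  · rintro ⟨⟨h1, h2⟩, ⟨h3, h4⟩, h⟩
    exact ⟨_, _, h, ⟨rfl, by positivity⟩, rfl, by positivity⟩

lemma sum_productPairs (n : ℕ) (F : (ℕ × ℕ) × (ℕ × ℕ) → ℚ) :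
    ∑ x ∈ productPairs n, F x = ∑ p ∈ Finset.HasAntidiagonal.antidiagonal n,
      ∑ y ∈ p.1.divisorsAntidiagonal, ∑ z ∈ p.2.divisorsAntidiagonal, F (y, z) := by
  rw [productPairs, Finset.sum_biUnion]
  · simp only [Finset.sum_product]
  · intro p _ p' _ hpp
    simp only [Function.onFun]
    rw [Finset.disjoint_left]
    intro x hx hx'
    simp only [Finset.mem_product, Nat.mem_divisorsAntidiagonal] at hx hx'
    exact hpp (Prod.ext (hx.1.1.symm.trans hx'.1.1) (hx.2.1.symm.trans hx'.2.1))

lemma coeff_biBracket_one (n s r : ℕ) :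
    PowerSeries.coeff n (biBracket 1 ![s] ![r]) =
      ∑ x ∈ n.divisorsAntidiagonal, dividedPow r x.1 * dividedPow (s - 1) x.2 := by
  rw [biBracket, PowerSeries.coeff_mk, ← finsum_mem_coe_finset]
  refine finsum_mem_eq_of_bijOn (fun uv => (uv.1 0, uv.2 0)) ⟨?_, ?_, ?_⟩ ?_
  · rintro ⟨u, v⟩ ⟨-, hu, hv, h⟩
    simp only [Fin.sum_univ_one] at h hu hv
    simp only [Finset.mem_coe, Nat.mem_divisorsAntidiagonal]
    refine ⟨h, ?_⟩
    rw [← h]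
    exact (Nat.mul_pos (hu 0) (hv 0)).ne'
  · rintro ⟨u, v⟩ - ⟨u', v'⟩ - h
    simp only [Prod.mk.injEq] at h
    ext i <;> fin_cases i
    · exact h.1
    · exact h.2
  · rintro ⟨u, v⟩ h
    simp only [Finset.mem_coe, Nat.mem_divisorsAntidiagonal] at h
    refine ⟨(![u], ![v]), ⟨Subsingleton.strictAnti _, ?_, ?_, ?_⟩, rfl⟩
    · intro i; fin_cases i
      exact Nat.pos_of_ne_zero fun h0 => h.2 (by
        have h0 : u = 0 := h0
        rw [← h.1, h0, zero_mul])
    · intro i; fin_cases i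
      exact Nat.pos_of_ne_zero fun h0 => h.2 (by
        have h0 : v = 0 := h0
        rw [← h.1, h0, mul_zero])
    · simpa using h.1
  · rintro ⟨u, v⟩ -
    simp [dividedPow]

lemma coeff_biBracket_two (n s₁ s₂ r₁ r₂ : ℕ) :
    PowerSeries.coeff n (biBracket 2 ![s₁, s₂] ![r₁, r₂]) =
      ∑ x ∈ productPairs n with x.2.1 < x.1.1,
        dividedPow r₁ x.1.1 * dividedPow (s₁ - 1) x.1.2 *
          (dividedPow r₂ x.2.1 * dividedPow (s₂ - 1) x.2.2) := by
  rw [biBracket, PowerSeries.coeff_mk, ← finsum_mem_coe_finset]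
  refine finsum_mem_eq_of_bijOn (fun uv => ((uv.1 0, uv.2 0), (uv.1 1, uv.2 1))) ⟨?_, ?_, ?_⟩ ?_
  · rintro ⟨u, v⟩ ⟨hlt, hu, hv, h⟩
    simp only [Fin.sum_univ_two] at h hu hv
    simp only [Finset.mem_coe, Finset.mem_filter, mem_productPairs]
    exact ⟨⟨⟨hu 0, hv 0⟩, ⟨hu 1, hv 1⟩, h⟩, hlt (by decide)⟩
  · rintro ⟨u, v⟩ - ⟨u', v'⟩ - h
    simp only [Prod.mk.injEq] at h
    ext i <;> fin_cases i
    · exact h.1.1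
    · exact h.2.1
    · exact h.1.2
    · exact h.2.2
  · rintro ⟨⟨u₁, v₁⟩, ⟨u₂, v₂⟩⟩ h
    simp only [Finset.mem_coe, Finset.mem_filter, mem_productPairs] at h
    obtain ⟨⟨⟨h1, h2⟩, ⟨h3, h4⟩, h5⟩, h6⟩ := h
    refine ⟨(![u₁, u₂], ![v₁, v₂]), ⟨?_, ?_, ?_, ?_⟩, rfl⟩
    · intro i j hij
      fin_cases i <;> fin_cases j <;> simp_all
    · intro i; fin_cases i <;> assumption
    · intro i; fin_cases i <;> assumption
    · simpa using h5
  · rintro ⟨u, v⟩ -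
    simp [dividedPow, Fin.prod_univ_two]

/-- The contribution to the coefficient of `qⁿ` in the product
`[a + 1; r₁] · [b + 1; r₂]` of one quadruple. -/
def shuffleWeight (a b r₁ r₂ : ℕ) (x : (ℕ × ℕ) × (ℕ × ℕ)) : ℚ :=
  dividedPow r₁ x.1.1 * dividedPow a x.1.2 * (dividedPow r₂ x.2.1 * dividedPow b x.2.2)

lemma coeff_biBracket_mul (n a b r₁ r₂ : ℕ) :
    PowerSeries.coeff n (biBracket 1 ![a + 1] ![r₁] * biBracket 1 ![b + 1] ![r₂]) =
      ∑ x ∈ productPairs n, shuffleWeight a b r₁ r₂ x := by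
  rw [PowerSeries.coeff_mul, sum_productPairs]
  simp only [coeff_biBracket_one, Finset.sum_mul_sum, shuffleWeight, Nat.add_sub_cancel]

lemma sum_shuffleWeight_lt (n a b r₁ r₂ : ℕ) :
    ∑ x ∈ productPairs n with x.2.2 < x.1.2, shuffleWeight a b r₁ r₂ x =
      ∑ j ∈ Finset.range (a + 1), ∑ k ∈ Finset.range (r₂ + 1),
        (((a + b - j).choose (a - j) : ℚ) * ((r₁ + r₂ - k).choose r₁ : ℚ) * (-1) ^ (r₂ - k)) *
          PowerSeries.coeff n (biBracket 2 ![a + b - j + 1, j + 1] ![k, r₁ + r₂ - k]) := by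
  have h : ∑ x ∈ productPairs n with x.2.2 < x.1.2, shuffleWeight a b r₁ r₂ x =
      ∑ y ∈ productPairs n with y.2.1 < y.1.1,
        (dividedPow a (y.2.2 + y.1.2) * dividedPow b y.1.2) *
          (dividedPow r₁ y.2.1 * dividedPow r₂ (y.1.1 - y.2.1)) := by
    refine Finset.sum_nbij' (fun x => ((x.1.1 + x.2.1, x.2.2), (x.1.1, x.1.2 - x.2.2)))
      (fun y => ((y.2.1, y.2.2 + y.1.2), (y.1.1 - y.2.1, y.1.2))) ?_ ?_ ?_ ?_ ?_
    · rintro ⟨⟨u₁, v₁⟩, ⟨u₂, v₂⟩⟩ hx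
      simp only [Finset.mem_filter, mem_productPairs] at hx ⊢
      obtain ⟨⟨⟨h1, h2⟩, ⟨h3, h4⟩, h5⟩, h6⟩ := hx
      obtain ⟨t, rfl⟩ := Nat.exists_eq_add_of_lt h6
      refine ⟨⟨⟨by omega, h4⟩, ⟨h1, by omega⟩, ?_⟩, by omega⟩
      rw [show v₂ + t + 1 - v₂ = t + 1 by omega, ← h5]
      ring
    · rintro ⟨⟨u₁, v₁⟩, ⟨u₂, v₂⟩⟩ hx
      simp only [Finset.mem_filter, mem_productPairs] at hx ⊢
      obtain ⟨⟨⟨h1, h2⟩, ⟨h3, h4⟩, h5⟩, h6⟩ := hx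
      obtain ⟨t, rfl⟩ := Nat.exists_eq_add_of_lt h6
      refine ⟨⟨⟨h3, by omega⟩, ⟨by omega, h2⟩, ?_⟩, by omega⟩
      rw [show u₂ + t + 1 - u₂ = t + 1 by omega, ← h5]
      ring
    · rintro ⟨⟨u₁, v₁⟩, ⟨u₂, v₂⟩⟩ hx
      simp only [Finset.mem_filter] at hx
      ext <;> simp; omega
    · rintro ⟨⟨u₁, v₁⟩, ⟨u₂, v₂⟩⟩ hx
      simp only [Finset.mem_filter] at hx
      ext <;> simp; omega
    · rintro ⟨⟨u₁, v₁⟩, ⟨u₂, v₂⟩⟩ hx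
      simp only [Finset.mem_filter] at hx
      simp only [shuffleWeight]
      rw [Nat.cast_sub hx.2.le]
      push_cast
      rw [sub_add_cancel, add_sub_cancel_left]
      ring
  rw [h]
  simp only [coeff_biBracket_two, Nat.add_sub_cancel, Finset.mul_sum]
  rw [Finset.sum_congr rfl fun j _ => Finset.sum_comm, Finset.sum_comm]
  refine Finset.sum_congr rfl fun y _ => ?_
  rw [dividedPow_add_mul, dividedPow_mul_sub, Finset.sum_mul_sum]
  refine Finset.sum_congr rfl fun j _ => Finset.sum_congr rfl fun k _ => ?_
  ring

lemma sum_shuffleWeight_gt (n a b r₁ r₂ : ℕ) :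
    ∑ x ∈ productPairs n with x.1.2 < x.2.2, shuffleWeight a b r₁ r₂ x =
      ∑ x ∈ productPairs n with x.2.2 < x.1.2, shuffleWeight b a r₂ r₁ x := by
  refine Finset.sum_nbij' Prod.swap Prod.swap ?_ ?_ (fun _ _ => rfl) (fun _ _ => rfl) ?_
  · intro x hx
    simp only [Finset.mem_filter, mem_productPairs, Prod.fst_swap, Prod.snd_swap] at hx ⊢
    exact ⟨⟨hx.1.2.1, hx.1.1, by rw [add_comm]; exact hx.1.2.2⟩, hx.2⟩
  · intro x hx
    simp only [Finset.mem_filter, mem_productPairs, Prod.fst_swap, Prod.snd_swap] at hx ⊢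
    exact ⟨⟨hx.1.2.1, hx.1.1, by rw [add_comm]; exact hx.1.2.2⟩, hx.2⟩
  · intro x _
    exact mul_comm _ _

lemma sum_shuffleWeight_eq (n a b r₁ r₂ : ℕ) :
    ∑ x ∈ productPairs n with x.1.2 = x.2.2, shuffleWeight a b r₁ r₂ x =
      ((a + b).choose a : ℚ) * ∑ y ∈ n.divisorsAntidiagonal,
        (dividedPow (r₁ + r₂ + 1) y.1 + bernoulliPart r₁ r₂ y.1 + bernoulliPart r₂ r₁ y.1) *
          dividedPow (a + b) y.2 := by
  have h : ∑ x ∈ productPairs n with x.1.2 = x.2.2, shuffleWeight a b r₁ r₂ x =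
      ∑ z ∈ n.divisorsAntidiagonal.sigma fun y => Finset.Ico 1 y.1,
        (dividedPow r₁ z.2 * dividedPow r₂ (z.1.1 - z.2)) *
          (dividedPow a z.1.2 * dividedPow b z.1.2) := by
    refine Finset.sum_nbij' (fun x => ⟨(x.1.1 + x.2.1, x.1.2), x.1.1⟩)
      (fun z => ((z.2, z.1.2), (z.1.1 - z.2, z.1.2))) ?_ ?_ ?_ ?_ ?_
    · rintro ⟨⟨u₁, v₁⟩, ⟨u₂, v₂⟩⟩ hx
      simp only [Finset.mem_filter, mem_productPairs, Finset.mem_sigma,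
        Nat.mem_divisorsAntidiagonal, Finset.mem_Ico] at hx ⊢
      obtain ⟨⟨⟨h1, h2⟩, ⟨h3, h4⟩, h5⟩, rfl⟩ := hx
      refine ⟨⟨by rw [← h5]; ring, ?_⟩, by omega⟩
      rw [← h5]
      positivity
    · rintro ⟨⟨u, v⟩, w⟩ hx
      simp only [Finset.mem_filter, mem_productPairs, Finset.mem_sigma,
        Nat.mem_divisorsAntidiagonal, Finset.mem_Ico] at hx ⊢
      obtain ⟨⟨h1, h2⟩, h3, h4⟩ := hx
      have hv : 0 < v := Nat.pos_of_ne_zero fun h0 => h2 (by rw [← h1, h0, mul_zero])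
      refine ⟨⟨⟨h3, hv⟩, ⟨by omega, hv⟩, ?_⟩, trivial⟩
      rw [← add_mul, Nat.add_sub_cancel' h4.le, h1]
    · rintro ⟨⟨u₁, v₁⟩, ⟨u₂, v₂⟩⟩ hx
      simp only [Finset.mem_filter] at hx
      ext <;> simp; omega
    · rintro ⟨⟨u, v⟩, w⟩ hx
      simp only [Finset.mem_sigma, Finset.mem_Ico] at hx
      have : w + (u - w) = u := by omega
      simp [this]
    · rintro ⟨⟨u₁, v₁⟩, ⟨u₂, v₂⟩⟩ hx
      simp only [Finset.mem_filter] at hx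
      obtain ⟨-, rfl⟩ := hx
      simp only [shuffleWeight]
      push_cast
      rw [add_sub_cancel_left]
      ring
  rw [h, Finset.sum_sigma, Finset.mul_sum]
  refine Finset.sum_congr rfl fun y hy => ?_
  have hy1 : 1 ≤ y.1 := by
    rw [Nat.mem_divisorsAntidiagonal] at hy
    exact Nat.pos_of_ne_zero fun h0 => hy.2 (by rw [← hy.1, h0, zero_mul])
  dsimp only
  rw [← Finset.sum_mul, sum_Ico_dividedPow_mul _ _ _ hy1, dividedPow_mul_dividedPow]
  ring

lemma sum_productPairs_trichotomy (n : ℕ) (F : (ℕ × ℕ) × (ℕ × ℕ) → ℚ) :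
    ∑ x ∈ productPairs n, F x =
      ∑ x ∈ productPairs n with x.2.2 < x.1.2, F x +
      ∑ x ∈ productPairs n with x.1.2 < x.2.2, F x +
      ∑ x ∈ productPairs n with x.1.2 = x.2.2, F x := by
  simp only [Finset.sum_filter]
  rw [← Finset.sum_add_distrib, ← Finset.sum_add_distrib]
  refine Finset.sum_congr rfl fun x _ => ?_
  rcases lt_trichotomy x.1.2 x.2.2 with h | h | h
  · simp [h, h.ne, h.not_gt]
  · simp [h]
  · simp [h, h.ne', h.not_gt]

lemma sum_bernoulliPart_mul (n a b s : ℕ) :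
    ∑ y ∈ n.divisorsAntidiagonal, bernoulliPart a b y.1 * dividedPow s y.2 =
      ∑ j ∈ Finset.range (a + 1),
        ((-1 : ℚ) ^ b * (bernoulli (a + b - j + 1) / ((a + b - j + 1)! : ℚ)) *
          ((a + b - j).choose (a - j) : ℚ)) *
          PowerSeries.coeff n (biBracket 1 ![s + 1] ![j]) := by
  simp only [coeff_biBracket_one, bernoulliPart, Finset.sum_mul, Finset.mul_sum,
    Nat.add_sub_cancel]
  rw [Finset.sum_comm]
  exact Finset.sum_congr rfl fun j _ => Finset.sum_congr rfl fun y _ => by ring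

/-- Shuffle product for bi-brackets in length one. -/
theorem biBracket_shuffle_length_one (s₁ s₂ r₁ r₂ : ℕ) (h₁ : 1 ≤ s₁) (h₂ : 1 ≤ s₂) :
    biBracket 1 ![s₁] ![r₁] * biBracket 1 ![s₂] ![r₂] =
      (∑ j ∈ Finset.Icc 1 s₁, ∑ k ∈ Finset.range (r₂ + 1),
          (((s₁ + s₂ - j - 1).choose (s₁ - j) : ℚ) * ((r₁ + r₂ - k).choose r₁ : ℚ) *
              (-1 : ℚ) ^ (r₂ - k)) •
            biBracket 2 ![s₁ + s₂ - j, j] ![k, r₁ + r₂ - k])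
      + (∑ j ∈ Finset.Icc 1 s₂, ∑ k ∈ Finset.range (r₁ + 1),
          (((s₁ + s₂ - j - 1).choose (s₁ - 1) : ℚ) * ((r₁ + r₂ - k).choose (r₁ - k) : ℚ) *
              (-1 : ℚ) ^ (r₁ - k)) •
            biBracket 2 ![s₁ + s₂ - j, j] ![k, r₁ + r₂ - k])
      + (((s₁ + s₂ - 2).choose (s₁ - 1) : ℚ)) • biBracket 1 ![s₁ + s₂ - 1] ![r₁ + r₂ + 1]
      + (((s₁ + s₂ - 2).choose (s₁ - 1) : ℚ)) •
          ∑ j ∈ Finset.range (r₁ + 1),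
            ((-1 : ℚ) ^ r₂ * (bernoulli (r₁ + r₂ - j + 1) / ((r₁ + r₂ - j + 1)! : ℚ)) *
                ((r₁ + r₂ - j).choose (r₁ - j) : ℚ)) •
              biBracket 1 ![s₁ + s₂ - 1] ![j]
      + (((s₁ + s₂ - 2).choose (s₁ - 1) : ℚ)) •
          ∑ j ∈ Finset.range (r₂ + 1),
            ((-1 : ℚ) ^ r₁ * (bernoulli (r₁ + r₂ - j + 1) / ((r₁ + r₂ - j + 1)! : ℚ)) *
                ((r₁ + r₂ - j).choose (r₂ - j) : ℚ)) •
              biBracket 1 ![s₁ + s₂ - 1] ![j] := by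
  obtain ⟨a, rfl⟩ := Nat.exists_eq_add_of_le' h₁
  obtain ⟨b, rfl⟩ := Nat.exists_eq_add_of_le' h₂
  have hIcc : ∀ (c : ℕ) (F : ℕ → ℚ),
      ∑ j ∈ Finset.Icc 1 (c + 1), F j = ∑ j ∈ Finset.range (c + 1), F (j + 1) := by
    intro c F
    rw [Finset.range_eq_Ico, Finset.sum_Ico_add' F 0 (c + 1) 1]
    rfl
  ext n
  rw [coeff_biBracket_mul, sum_productPairs_trichotomy, sum_shuffleWeight_gt,
    sum_shuffleWeight_lt, sum_shuffleWeight_lt, sum_shuffleWeight_eq]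
  simp only [add_mul, Finset.sum_add_distrib, sum_bernoulliPart_mul, map_add, map_sum,
    PowerSeries.coeff_smul, smul_eq_mul, hIcc]
  rw [show a + 1 + (b + 1) - 2 = a + b by omega, show a + 1 + (b + 1) - 1 = a + b + 1 by omega,
    show a + 1 - 1 = a by omega, coeff_biBracket_one n (a + b + 1) (r₁ + r₂ + 1),
    Nat.add_sub_cancel, mul_add, mul_add]
  simp only [← add_assoc]
  congr 1
  · congr 1
    · congr 1
      congr 1
      · refine Finset.sum_congr rfl fun j hj => Finset.sum_congr rfl fun k _ => ?_
        have hj : j < a + 1 := Finset.mem_range.1 hj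
        rw [show a + 1 + b + 1 - (j + 1) - 1 = a + b - j by omega,
          show a + 1 + b + 1 - (j + 1) = a + b - j + 1 by omega,
          show a + 1 - (j + 1) = a - j by omega]
      · refine Finset.sum_congr rfl fun j hj => Finset.sum_congr rfl fun k hk => ?_
        have hj : j < b + 1 := Finset.mem_range.1 hj
        have hk : k < r₁ + 1 := Finset.mem_range.1 hk
        rw [show a + 1 + b + 1 - (j + 1) - 1 = a + b - j by omega,
          show a + 1 + b + 1 - (j + 1) = a + b - j + 1 by omega, add_comm b a, add_comm r₂ r₁,
          Nat.choose_symm_of_eq_add (show a + b - j = (b - j) + a by omega),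
          Nat.choose_symm_of_eq_add (show r₁ + r₂ - k = r₂ + (r₁ - k) by omega)]
  · rw [add_comm r₂ r₁]
end

section
/- (The conjecture 'bi-brackets lie in the algebra of brackets' holds in length one.) For all integers s ≥ 1 and r ≥ 0, the bi-bracket [s; r] lies in the ℚ-vector subspace of ℚ[[q]] spanned by 1 together with the brackets [t₁,…,t_m] with 1 ≤ m ≤ r+1, t₁,…,t_m ≥ 1 and t₁ + … + t_m ≤ s + r. -/
open scoped Nat

open Finset PowerSeries

/-- The series `∑_{v ≥ 1} G (u + 1) v q ^ ((u + 1) v)`. -/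
noncomputable def letter (G : ℕ → ℕ → ℚ) (u : ℕ) : PowerSeries ℚ :=
  expand (u + 1) u.succ_ne_zero (PowerSeries.mk fun v => if v = 0 then 0 else G (u + 1) v)

theorem coeff_letter (G : ℕ → ℕ → ℚ) (u c : ℕ) :
    coeff c (letter G u) = if (u + 1) ∣ c ∧ 0 < c then G (u + 1) (c / (u + 1)) else 0 := by
  by_cases h : (u + 1) ∣ c
  · obtain ⟨v, rfl⟩ := h
    rw [letter, coeff_expand_mul, coeff_mk]
    rcases Nat.eq_zero_or_pos v with rfl | hv
    · simp
    · simp [hv.ne', hv]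
  · rw [letter, coeff_expand_of_not_dvd _ _ _ h]
    simp [h]

theorem letter_mul (G H : ℕ → ℕ → ℚ) (u : ℕ) :
    letter G u * letter H u =
      letter (fun u v => ∑ k ∈ Ico 1 v, G u k * H u (v - k)) u := by
  rw [letter, letter, letter, ← map_mul]
  congr 1
  ext v
  rw [coeff_mul, coeff_mk, Nat.sum_antidiagonal_eq_sum_range_succ_mk]
  simp only [coeff_mk]
  rcases Nat.eq_zero_or_pos v with rfl | hv
  · simp
  · rw [if_neg hv.ne', range_eq_Ico, sum_eq_sum_Ico_succ_bot (by omega), sum_Ico_succ_top hv]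
    simp only [if_true, zero_mul, zero_add, Nat.sub_self, mul_zero, add_zero]
    refine sum_congr rfl fun k hk => ?_
    rw [mem_Ico] at hk
    rw [if_neg (by omega), if_neg (by omega)]

/-- The derivation `q d/dq`. -/
noncomputable def theta : Derivation ℚ (PowerSeries ℚ) (PowerSeries ℚ) :=
  (PowerSeries.X : PowerSeries ℚ) • PowerSeries.derivative ℚ

theorem coeff_theta (f : PowerSeries ℚ) (n : ℕ) : coeff n (theta f) = n * coeff n f := by
  rw [theta, Derivation.smul_apply, smul_eq_mul]
  cases n with
  | zero => simp
  | succ n => rw [coeff_succ_X_mul, coeff_derivative]; push_cast; ring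

theorem theta_letter (G : ℕ → ℕ → ℚ) (u : ℕ) :
    theta (letter G u) = letter (fun u v => u * v * G u v) u := by
  ext c
  rw [coeff_theta, coeff_letter, coeff_letter]
  split_ifs with h
  · obtain ⟨⟨v, rfl⟩, h⟩ := h
    rw [Nat.mul_div_cancel_left _ u.succ_pos]
    push_cast; ring
  · simp

/-- The letters `∑_v v ^ p q ^ (u v)`, whose nested sums are the brackets. -/
noncomputable def partLetter (p : ℕ) : ℕ → PowerSeries ℚ := letter fun _ v => (v : ℚ) ^ p

/-- The letters `∑_v u ^ p q ^ (u v)`, whose nested sums are the conjugate brackets. -/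
noncomputable def conjLetter (p : ℕ) : ℕ → PowerSeries ℚ := letter fun u _ => (u : ℚ) ^ p

theorem exists_partLetter_mul_one (p : ℕ) :
    ∃ c : ℕ → ℚ, ∀ u, partLetter p u * partLetter 1 u =
      ∑ j ∈ range (p + 3), c j • partLetter j u := by
  have faulhaber (p : ℕ) : ∃ c : ℕ → ℚ, ∀ v : ℕ,
      ∑ k ∈ Ico 1 (v + 1), (k : ℚ) ^ p = ∑ j ∈ range (p + 2), c j * (v : ℚ) ^ j := by
    refine ⟨fun j => if j = 0 then 0 else
      bernoulli' (p + 1 - j) * (p + 1).choose (p + 1 - j) / (p + 1), fun v => ?_⟩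
    rw [sum_Ico_pow, ← sum_range_reflect, sum_range_succ' _ (p + 1)]
    simp only [if_true, zero_mul, add_zero, Nat.succ_ne_zero, if_false]
    refine sum_congr rfl fun i hi => ?_
    rw [mem_range] at hi
    rw [show p + 1 - (p + 1 - 1 - i) = i + 1 by omega, show p + 1 - 1 - i = p + 1 - (i + 1) by omega]
    ring
  obtain ⟨c, hc⟩ := faulhaber p
  obtain ⟨d, hd⟩ := faulhaber (p + 1)
  refine ⟨fun j => (if j = 0 then 0 else c (j - 1)) - d j, fun u => ?_⟩
  unfold partLetter
  rw [letter_mul]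
  ext n
  simp only [map_sum, coeff_smul, coeff_letter, smul_eq_mul]
  split_ifs with h
  · generalize n / (u + 1) = v
    have h1 : ∑ k ∈ Ico 1 v, (k : ℚ) ^ p * ((v - k : ℕ) : ℚ) ^ 1 =
        v * ∑ k ∈ Ico 1 (v + 1), (k : ℚ) ^ p - ∑ k ∈ Ico 1 (v + 1), (k : ℚ) ^ (p + 1) := by
      rcases Nat.eq_zero_or_pos v with rfl | hv
      · simp
      · rw [mul_sum, ← sum_sub_distrib, sum_Ico_succ_top hv,
          show (v : ℚ) * v ^ p - v ^ (p + 1) = 0 by ring, add_zero]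
        refine sum_congr rfl fun k hk => ?_
        rw [Nat.cast_sub (mem_Ico.1 hk).2.le]
        ring
    rw [h1, hc, hd]
    simp only [sub_mul, sum_sub_distrib]
    congr 1
    rw [sum_range_succ' _ (p + 2), mul_sum]
    simp only [if_true, zero_mul, add_zero, Nat.succ_ne_zero, if_false, Nat.add_sub_cancel]
    exact sum_congr rfl fun j _ => by ring
  · simp

theorem theta_conjLetter (p u : ℕ) :
    theta (conjLetter p u) = conjLetter p u * conjLetter 1 u + conjLetter (p + 1) u := by
  unfold conjLetter
  rw [theta_letter, letter_mul]
  ext n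
  rw [map_add]
  simp only [coeff_letter]
  split_ifs with h
  · have hv : 1 ≤ n / (u + 1) := Nat.div_pos (Nat.le_of_dvd h.2 h.1) u.succ_pos
    generalize n / (u + 1) = v at hv
    rw [sum_const, Nat.card_Ico, nsmul_eq_mul, Nat.cast_sub hv]
    push_cast; ring
  · simp

/-- The truncated nested sum `∑_{N > u₁ > u₂ > …} a i₁ u₁ * a i₂ u₂ * …`. -/
noncomputable def nestedSum (a : ℕ → ℕ → PowerSeries ℚ) : List ℕ → ℕ → PowerSeries ℚ
  | [], _ => 1
  | i :: w, N => ∑ u ∈ range N, a i u * nestedSum a w u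

/-- Prepending a letter to a nested sum, as a linear operator. -/
noncomputable def prepend (a : ℕ → PowerSeries ℚ) :
    (ℕ → PowerSeries ℚ) →ₗ[ℚ] (ℕ → PowerSeries ℚ) where
  toFun f N := ∑ u ∈ range N, a u * f u
  map_add' f g := by ext1 N; simp [mul_add, sum_add_distrib]
  map_smul' c f := by ext1 N; simp [smul_sum]

theorem nestedSum_cons (a : ℕ → ℕ → PowerSeries ℚ) (i : ℕ) (w : List ℕ) :
    nestedSum a (i :: w) = prepend (a i) (nestedSum a w) := rfl

/-- The span of the nested sums of bounded weight and length. -/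
noncomputable def nestedSpan (a : ℕ → ℕ → PowerSeries ℚ) (k l : ℕ) :
    Submodule ℚ (ℕ → PowerSeries ℚ) :=
  Submodule.span ℚ {f | ∃ w : List ℕ, w.length ≤ l ∧ w.sum + w.length ≤ k ∧ f = nestedSum a w}

theorem nestedSum_mem (a : ℕ → ℕ → PowerSeries ℚ) {k l : ℕ} (w : List ℕ) (hl : w.length ≤ l)
    (hk : w.sum + w.length ≤ k) : nestedSum a w ∈ nestedSpan a k l :=
  Submodule.subset_span ⟨w, hl, hk, rfl⟩

theorem nestedSpan_mono (a : ℕ → ℕ → PowerSeries ℚ) {k k' l l' : ℕ} (hk : k ≤ k') (hl : l ≤ l') :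
    nestedSpan a k l ≤ nestedSpan a k' l' := by
  refine Submodule.span_mono ?_
  rintro f ⟨w, h1, h2, rfl⟩
  exact ⟨w, h1.trans hl, h2.trans hk, rfl⟩

theorem prepend_mem (a : ℕ → ℕ → PowerSeries ℚ) {k l : ℕ} (i : ℕ) {f : ℕ → PowerSeries ℚ}
    (hf : f ∈ nestedSpan a k l) : prepend (a i) f ∈ nestedSpan a (k + i + 1) (l + 1) := by
  suffices h : nestedSpan a k l ≤ (nestedSpan a (k + i + 1) (l + 1)).comap (prepend (a i)) from h hf
  refine Submodule.span_le.2 ?_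
  rintro f ⟨w, h1, h2, rfl⟩
  refine nestedSum_mem a (i :: w) (by simpa using h1) ?_
  simp only [List.sum_cons, List.length_cons]
  omega

/-- The quasi-shuffle product of two nested sums. -/
theorem prepend_mul_prepend (a b f g : ℕ → PowerSeries ℚ) :
    prepend a f * prepend b g =
      prepend a (f * prepend b g) + prepend b (prepend a f * g) + prepend (a * b) (f * g) := by
  ext1 N
  simp only [prepend, LinearMap.coe_mk, AddHom.coe_mk, Pi.mul_apply, Pi.add_apply]
  induction N with
  | zero => simp
  | succ N ih =>
    simp only [sum_range_succ]
    rw [add_mul, mul_add, mul_add, ih]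
    ring

theorem nestedSum_mul_one_mem (w : List ℕ) :
    nestedSum partLetter w * nestedSum partLetter [1] ∈
      nestedSpan partLetter (w.sum + w.length + 2) (w.length + 1) := by
  induction w with
  | nil =>
    rw [show nestedSum partLetter [] = 1 from rfl, one_mul]
    exact nestedSum_mem _ _ (by simp) (by simp)
  | cons i w ih =>
    rw [nestedSum_cons, nestedSum_cons, prepend_mul_prepend, ← nestedSum_cons _ 1 [],
      show nestedSum partLetter [] = 1 from rfl, mul_one, mul_one, ← nestedSum_cons,
      ← nestedSum_cons]
    simp only [List.sum_cons, List.length_cons]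
    refine add_mem (add_mem ?_ ?_) ?_
    · exact nestedSpan_mono _ (by omega) (by omega) (prepend_mem _ i ih)
    · exact nestedSum_mem _ _ (by simp) (by simp; omega)
    · obtain ⟨c, hc⟩ := exists_partLetter_mul_one i
      have : prepend (partLetter i * partLetter 1) (nestedSum partLetter w) =
          ∑ j ∈ range (i + 3), c j • nestedSum partLetter (j :: w) := by
        ext1 N
        simp only [prepend, LinearMap.coe_mk, AddHom.coe_mk, Pi.mul_apply, hc, sum_mul,
          Finset.sum_apply, Pi.smul_apply, nestedSum, smul_sum, smul_mul_assoc]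
        rw [sum_comm]
      rw [this]
      refine sum_mem fun j hj => Submodule.smul_mem _ _ (nestedSum_mem _ _ (by simp) ?_)
      rw [mem_range] at hj
      simp only [List.sum_cons, List.length_cons]
      omega

theorem theta_nestedSum_sub_mem (w : List ℕ) :
    (fun N => theta (nestedSum conjLetter w N)) - nestedSum conjLetter w * nestedSum conjLetter [1] ∈
      nestedSpan conjLetter (w.sum + w.length + 2) (w.length + 1) := by
  induction w with
  | nil =>
    have : (fun N => theta (nestedSum conjLetter [] N)) = 0 := by
      ext1 N; simp [nestedSum]
    rw [this, show nestedSum conjLetter [] = 1 from rfl, one_mul, zero_sub]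
    exact neg_mem (nestedSum_mem _ _ (by simp) (by simp))
  | cons i w ih =>
    have : (fun N => theta (nestedSum conjLetter (i :: w) N)) =
        prepend (conjLetter i * conjLetter 1) (nestedSum conjLetter w) +
        nestedSum conjLetter ((i + 1) :: w) +
        prepend (conjLetter i) (fun N => theta (nestedSum conjLetter w N)) := by
      ext1 N
      simp only [nestedSum, prepend, LinearMap.coe_mk, AddHom.coe_mk, Pi.mul_apply, Pi.add_apply,
        map_sum, Derivation.leibniz, theta_conjLetter, ← sum_add_distrib, smul_eq_mul]
      exact sum_congr rfl fun u _ => by ring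
    rw [this, nestedSum_cons _ i w, nestedSum_cons _ 1 [], prepend_mul_prepend,
      ← nestedSum_cons _ 1 [], show nestedSum conjLetter [] = 1 from rfl, mul_one, mul_one,
      ← nestedSum_cons _ i, ← nestedSum_cons _ 1]
    have key : ∀ x y z t s : ℕ → PowerSeries ℚ, x + y + z - (s + t + x) = y + (z - s) - t := by
      intros; ring
    rw [key, ← map_sub]
    simp only [List.sum_cons, List.length_cons]
    refine sub_mem (add_mem ?_ ?_) ?_
    · exact nestedSum_mem _ _ (by simp) (by simp; omega)
    · exact nestedSpan_mono _ (by omega) (by omega) (prepend_mem _ i ih)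
    · exact nestedSum_mem _ _ (by simp) (by simp; omega)

/-- The index tuples of a bi-bracket contributing to the coefficient of `q ^ n`. -/
def bracketIndex (m n : ℕ) : Set ((Fin m → ℕ) × (Fin m → ℕ)) :=
  {uv | StrictAnti uv.1 ∧ (∀ j, 0 < uv.1 j) ∧ (∀ j, 0 < uv.2 j) ∧ (∑ j, uv.1 j * uv.2 j) = n}

theorem bracketIndex_le {m n : ℕ} {uv : (Fin m → ℕ) × (Fin m → ℕ)} (h : uv ∈ bracketIndex m n)
    (j : Fin m) : uv.1 j ≤ n ∧ uv.2 j ≤ n := by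
  obtain ⟨-, h1, h2, h3⟩ := h
  have : uv.1 j * uv.2 j ≤ n :=
    h3 ▸ single_le_sum (f := fun j => uv.1 j * uv.2 j) (fun _ _ => Nat.zero_le _) (mem_univ j)
  exact ⟨(Nat.le_mul_of_pos_right _ (h2 j)).trans this,
    (Nat.le_mul_of_pos_left _ (h1 j)).trans this⟩

theorem bracketIndex_finite (m n : ℕ) : (bracketIndex m n).Finite :=
  ((Set.finite_Icc (0 : Fin m → ℕ) fun _ => n).prod (Set.finite_Icc 0 fun _ => n)).subset
    fun _ h => ⟨⟨fun _ => Nat.zero_le _, fun j => (bracketIndex_le h j).1⟩,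
      fun _ => Nat.zero_le _, fun j => (bracketIndex_le h j).2⟩

/-- The finite set of index tuples. -/
noncomputable def bracketFinset (m n : ℕ) : Finset ((Fin m → ℕ) × (Fin m → ℕ)) :=
  (bracketIndex_finite m n).toFinset

theorem mem_bracketFinset {m n : ℕ} {uv : (Fin m → ℕ) × (Fin m → ℕ)} :
    uv ∈ bracketFinset m n ↔
      StrictAnti uv.1 ∧ (∀ j, 0 < uv.1 j) ∧ (∀ j, 0 < uv.2 j) ∧ (∑ j, uv.1 j * uv.2 j) = n :=
  (bracketIndex_finite m n).mem_toFinset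

/-- Extension of a tuple by zero. -/
def extendZero {m : ℕ} (x : Fin m → ℕ) (i : ℕ) : ℕ := if h : i < m then x ⟨i, h⟩ else 0

/-- Partial sums of a tuple. -/
def partialSum {m : ℕ} (v : Fin m → ℕ) (t : ℕ) : ℕ := ∑ i ∈ range t, extendZero v i

/-- The reversal of a tuple, preceded by a zero. -/
def zeroReverse {m : ℕ} (u : Fin m → ℕ) (t : ℕ) : ℕ := if t = 0 then 0 else extendZero u (m - t)

/-- Conjugation of a partition given by its distinct parts and their multiplicities. -/
def conjugate {m : ℕ} (uv : (Fin m → ℕ) × (Fin m → ℕ)) : (Fin m → ℕ) × (Fin m → ℕ) :=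
  (fun j => partialSum uv.2 (m - j), fun j => zeroReverse uv.1 (j + 1) - zeroReverse uv.1 j)

theorem extendZero_coe {m : ℕ} (x : Fin m → ℕ) (j : Fin m) : extendZero x j = x j := by
  simp [extendZero]

theorem zeroReverse_lt {m : ℕ} {u : Fin m → ℕ} (hu : StrictAnti u) (hpos : ∀ j, 0 < u j) {t : ℕ}
    (ht : t < m) : zeroReverse u t < zeroReverse u (t + 1) := by
  rw [zeroReverse, zeroReverse, if_neg t.succ_ne_zero, extendZero, extendZero,
    dif_pos (show m - (t + 1) < m by omega)]
  split_ifs with h h'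
  · exact hpos _
  · exact hu (by rw [Fin.mk_lt_mk]; omega)
  · exact hpos _

theorem zeroReverse_conjugate {m : ℕ} (uv : (Fin m → ℕ) × (Fin m → ℕ)) {t : ℕ} (ht : t ≤ m) :
    zeroReverse (conjugate uv).1 t = partialSum uv.2 t := by
  rw [zeroReverse]
  split_ifs with h
  · simp [h, partialSum]
  · rw [extendZero, dif_pos (by omega)]
    simp only [conjugate]
    rw [Nat.sub_sub_self ht]

theorem partialSum_conjugate {m : ℕ} {uv : (Fin m → ℕ) × (Fin m → ℕ)} (hu : StrictAnti uv.1)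
    (hpos : ∀ j, 0 < uv.1 j) {t : ℕ} (ht : t ≤ m) :
    partialSum (conjugate uv).2 t = zeroReverse uv.1 t := by
  induction t with
  | zero => simp [partialSum, zeroReverse]
  | succ t ih =>
    have h1 := ih (by omega)
    have h2 := zeroReverse_lt hu hpos (show t < m by omega)
    rw [partialSum, sum_range_succ, ← partialSum, h1, extendZero, dif_pos (by omega)]
    simp only [conjugate]
    omega

theorem conjugate_conjugate {m : ℕ} {uv : (Fin m → ℕ) × (Fin m → ℕ)} (hu : StrictAnti uv.1)
    (hpos : ∀ j, 0 < uv.1 j) : conjugate (conjugate uv) = uv := by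
  ext j
  · change partialSum (conjugate uv).2 (m - j) = _
    rw [partialSum_conjugate hu hpos (by omega), zeroReverse, if_neg (by omega),
      Nat.sub_sub_self j.2.le, extendZero_coe]
  · change zeroReverse (conjugate uv).1 (j + 1) - zeroReverse (conjugate uv).1 j = _
    rw [zeroReverse_conjugate uv j.2, zeroReverse_conjugate uv j.2.le, partialSum, partialSum,
      sum_range_succ, extendZero_coe]
    omega

theorem sum_mul_reverse_diff (P Q : ℕ → ℤ) (m : ℕ) (hP : P 0 = 0) (hQ : Q 0 = 0) :
    ∑ j ∈ range m, P (m - j) * (Q (j + 1) - Q j) =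
      ∑ j ∈ range m, Q (m - j) * (P (j + 1) - P j) := by
  rw [← sum_range_reflect]
  have h1 : ∑ j ∈ range m, P (m - (m - 1 - j)) * (Q (m - 1 - j + 1) - Q (m - 1 - j)) =
      ∑ j ∈ range m, P (j + 1) * (Q (m - j) - Q (m - (j + 1))) := by
    refine sum_congr rfl fun j hj => ?_
    rw [mem_range] at hj
    rw [show m - (m - 1 - j) = j + 1 by omega, show m - 1 - j + 1 = m - j by omega,
      show m - 1 - j = m - (j + 1) by omega]
  have h2 := sum_range_succ (fun j => P j * Q (m - j)) m
  rw [sum_range_succ'] at h2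
  simp only [Nat.sub_self, hP, hQ, zero_mul, mul_zero, add_zero] at h2
  rw [h1]
  simp only [mul_sub, sum_sub_distrib, h2]
  congr 1 <;> exact sum_congr rfl fun j _ => mul_comm _ _

theorem conjugate_mem {m n : ℕ} {uv : (Fin m → ℕ) × (Fin m → ℕ)} (h : uv ∈ bracketFinset m n) :
    conjugate uv ∈ bracketFinset m n := by
  rw [mem_bracketFinset] at h ⊢
  obtain ⟨hu, hupos, hvpos, hsum⟩ := h
  have hmono : ∀ s t, s < t → t ≤ m → partialSum uv.2 s < partialSum uv.2 t := fun s t hst ht => by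
    refine sum_lt_sum_of_subset (range_mono hst.le) (mem_range.2 hst) (by simp) ?_
      fun _ _ _ => Nat.zero_le _
    rw [extendZero, dif_pos (by omega)]
    exact hvpos _
  refine ⟨fun i j hij => hmono _ _ (by have := j.2; have : (i : ℕ) < j := hij; omega) (by omega),
    fun j => ?_, fun j => Nat.sub_pos_of_lt (zeroReverse_lt hu hupos j.2), ?_⟩
  · simpa [partialSum, conjugate] using hmono 0 (m - j) (by omega) (by omega)
  · rw [← hsum]
    zify
    have h1 : ∀ j : Fin m, ((conjugate uv).1 j : ℤ) * (conjugate uv).2 j =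
        (fun j : ℕ => (partialSum uv.2 (m - j) : ℤ) *
          ((zeroReverse uv.1 (j + 1) : ℤ) - zeroReverse uv.1 j)) j := fun j => by
      simp only [conjugate]
      rw [Nat.cast_sub (zeroReverse_lt hu hupos j.2).le]
    have h2 : ∀ j : Fin m, (uv.1 j : ℤ) * uv.2 j =
        (fun j : ℕ => (zeroReverse uv.1 (m - j) : ℤ) *
          ((partialSum uv.2 (j + 1) : ℤ) - partialSum uv.2 j)) j := fun j => by
      simp only
      rw [partialSum, partialSum, sum_range_succ, zeroReverse, if_neg (by omega),
        Nat.sub_sub_self j.2.le, extendZero_coe, extendZero_coe]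
      push_cast; ring
    rw [sum_congr rfl fun j _ => h1 j, sum_congr rfl fun j _ => h2 j,
      Fin.sum_univ_eq_sum_range (fun j : ℕ => (partialSum uv.2 (m - j) : ℤ) *
          ((zeroReverse uv.1 (j + 1) : ℤ) - zeroReverse uv.1 j)),
      Fin.sum_univ_eq_sum_range (fun j : ℕ => (zeroReverse uv.1 (m - j) : ℤ) *
          ((partialSum uv.2 (j + 1) : ℤ) - partialSum uv.2 j))]
    exact sum_mul_reverse_diff (fun t => (partialSum uv.2 t : ℤ)) (fun t => (zeroReverse uv.1 t : ℤ))
      m (by simp [partialSum]) (by simp [zeroReverse])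

theorem sum_conjugate {m n : ℕ} (F : (Fin m → ℕ) × (Fin m → ℕ) → ℚ) :
    ∑ uv ∈ bracketFinset m n, F (conjugate uv) = ∑ uv ∈ bracketFinset m n, F uv := by
  have hinv : ∀ uv ∈ bracketFinset m n, conjugate (conjugate uv) = uv := fun uv h => by
    rw [mem_bracketFinset] at h
    exact conjugate_conjugate h.1 h.2.1
  exact sum_nbij' conjugate conjugate (fun _ => conjugate_mem) (fun _ => conjugate_mem) hinv hinv
    fun _ _ => rfl

/-- Polynomial functions of bounded total degree. -/
noncomputable def polyFun (m D : ℕ) : Submodule ℚ ((Fin m → ℕ) → ℚ) :=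
  Submodule.span ℚ {f | ∃ p : Fin m → ℕ, ∑ j, p j ≤ D ∧ f = fun x => ∏ j, (x j : ℚ) ^ p j}

theorem coord_mem_polyFun {m : ℕ} (j : Fin m) : (fun x => (x j : ℚ)) ∈ polyFun m 1 := by
  refine Submodule.subset_span ⟨Pi.single j 1, by simp, ?_⟩
  ext x
  rw [prod_eq_single j (fun i _ hi => by simp [hi]) (by simp)]
  simp

theorem mul_mem_polyFun {m D E : ℕ} {f g : (Fin m → ℕ) → ℚ} (hf : f ∈ polyFun m D)
    (hg : g ∈ polyFun m E) : f * g ∈ polyFun m (D + E) := by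
  have h := Submodule.mul_mem_mul hf hg
  rw [polyFun, polyFun, Submodule.span_mul_span] at h
  refine Submodule.span_mono ?_ h
  rintro _ ⟨_, ⟨p, hp, rfl⟩, _, ⟨q, hq, rfl⟩, rfl⟩
  refine ⟨p + q, by simp only [Pi.add_apply, sum_add_distrib]; omega, ?_⟩
  ext x
  simp [pow_add, prod_mul_distrib]

theorem one_mem_polyFun (m D : ℕ) : (1 : (Fin m → ℕ) → ℚ) ∈ polyFun m D :=
  Submodule.subset_span ⟨0, by simp, by ext; simp⟩

theorem prod_pow_mem_polyFun {m : ℕ} {f : Fin m → (Fin m → ℕ) → ℚ} (hf : ∀ j, f j ∈ polyFun m 1)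
    (p : Fin m → ℕ) : (∏ j, f j ^ p j) ∈ polyFun m (∑ j, p j) := by
  have hpow (j : Fin m) (e : ℕ) : f j ^ e ∈ polyFun m e := by
    induction e with
    | zero => rw [pow_zero]; exact one_mem_polyFun m 0
    | succ e ih => rw [pow_succ]; exact mul_mem_polyFun ih (hf j)
  have (s : Finset (Fin m)) : (∏ j ∈ s, f j ^ p j) ∈ polyFun m (∑ j ∈ s, p j) := by
    classical
    induction s using Finset.induction_on with
    | empty => exact one_mem_polyFun m 0
    | insert j s hj ih => rw [prod_insert hj, sum_insert hj]; exact mul_mem_polyFun (hpow j _) ih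
  exact this univ

theorem extendZero_mem_polyFun {m : ℕ} (i : ℕ) : (fun x => (extendZero x i : ℚ)) ∈ polyFun m 1 := by
  by_cases h : i < m
  · simpa [extendZero, h] using coord_mem_polyFun (⟨i, h⟩ : Fin m)
  · simp only [extendZero, h, dif_neg, not_false_eq_true, Nat.cast_zero]; exact zero_mem _

theorem partialSum_mem_polyFun {m : ℕ} (t : ℕ) : (fun x => (partialSum x t : ℚ)) ∈ polyFun m 1 := by
  have : (fun x : Fin m → ℕ => (partialSum x t : ℚ)) =
      ∑ i ∈ range t, fun x => (extendZero x i : ℚ) := by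
    ext x; simp [partialSum]
  rw [this]
  exact sum_mem fun i _ => extendZero_mem_polyFun i

theorem zeroReverse_mem_polyFun {m : ℕ} (t : ℕ) :
    (fun x => (zeroReverse x t : ℚ)) ∈ polyFun m 1 := by
  by_cases h : t = 0
  · simp only [zeroReverse, h, if_true, Nat.cast_zero]; exact zero_mem _
  · simpa [zeroReverse, h] using extendZero_mem_polyFun (m := m) (m - t)

theorem coeff_nestedSum (G : ℕ → ℕ → ℕ → ℚ) {m : ℕ} (p : Fin m → ℕ) (N n : ℕ) :
    coeff n (nestedSum (fun i => letter (G i)) (List.ofFn p) N) =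
      ∑ uv ∈ bracketFinset m n with ∀ j, uv.1 j ≤ N, ∏ j, G (p j) (uv.1 j) (uv.2 j) := by
  induction m generalizing N n with
  | zero =>
    simp only [List.ofFn_zero, nestedSum, coeff_one, univ_eq_empty, prod_empty, IsEmpty.forall_iff,
      filter_true, sum_const, nsmul_eq_mul, mul_one]
    split_ifs with h
    · have : bracketFinset 0 n = {default} := by
        ext uv
        simp [mem_bracketFinset, h, StrictAnti, Subsingleton.elim uv default]
      simp [this]
    · have : bracketFinset 0 n = ∅ := by
        ext uv
        simp [mem_bracketFinset, Ne.symm h]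
      simp [this]
  | succ m ih =>
    rw [List.ofFn_succ, nestedSum, map_sum,
      ← sum_fiberwise_of_maps_to (s := {uv ∈ bracketFinset (m + 1) n | ∀ j, uv.1 j ≤ N})
        (t := range N) (g := fun uv => uv.1 0 - 1)]
    swap
    · intro uv h
      rw [mem_filter, mem_bracketFinset] at h
      have := h.2 0
      have := h.1.2.1 0
      rw [mem_range]
      omega
    refine sum_congr rfl fun u hu => ?_
    rw [mem_range] at hu
    rw [coeff_mul, ← sum_fiberwise_of_maps_to (t := antidiagonal n)
      (g := fun uv : (Fin (m + 1) → ℕ) × (Fin (m + 1) → ℕ) =>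
        (uv.1 0 * uv.2 0, ∑ j : Fin m, uv.1 j.succ * uv.2 j.succ))]
    swap
    · intro uv h
      rw [mem_filter, mem_filter, mem_bracketFinset, Fin.sum_univ_succ] at h
      rw [HasAntidiagonal.mem_antidiagonal]
      exact h.1.1.2.2.2
    refine sum_congr rfl ?_
    rintro ⟨c, d⟩ hcd
    rw [HasAntidiagonal.mem_antidiagonal] at hcd
    simp only [filter_filter]
    rw [coeff_letter, ih (fun j => p j.succ) u d]
    split_ifs with hc
    · obtain ⟨⟨v, rfl⟩, hv⟩ := hc
      have hv : 0 < v := Nat.pos_of_mul_pos_left hv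
      rw [Nat.mul_div_cancel_left _ u.succ_pos, mul_sum]
      refine sum_nbij' (fun uv => (Fin.cons (u + 1) uv.1, Fin.cons v uv.2))
        (fun uv => (fun j => uv.1 j.succ, fun j => uv.2 j.succ)) ?_ ?_ ?_ ?_ ?_
      · intro uv h
        simp only [mem_filter, mem_bracketFinset] at h ⊢
        obtain ⟨⟨h1, h2, h3, h4⟩, h5⟩ := h
        refine ⟨⟨fun i j => ?_, ?_, ?_, ?_⟩, ⟨?_, ?_⟩, ?_⟩
        · refine Fin.cases ?_ (fun j => ?_) j
          · simp
          · refine Fin.cases (fun _ => ?_) (fun i hij => ?_) i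
            · simpa using Nat.lt_succ_of_le (h5 j)
            · simpa using h1 (Fin.succ_lt_succ_iff.1 hij)
        · exact Fin.cases (by simp) (by simpa using h2)
        · exact Fin.cases (by simpa using hv) (by simpa using h3)
        · rw [Fin.sum_univ_succ]
          simpa [h4] using hcd
        · exact Fin.cases (by simpa using hu) (by simpa using fun j => (h5 j).trans hu.le)
        · simp
        · simp [h4]
      · intro uv h
        simp only [mem_filter, mem_bracketFinset, Prod.mk.injEq] at h ⊢
        obtain ⟨⟨h1, h2, h3, h4⟩, ⟨h5, h6⟩, h7, h8⟩ := h
        refine ⟨⟨fun i j hij => h1 (Fin.succ_lt_succ_iff.2 hij), fun j => h2 _, fun j => h3 _, h8⟩,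
          fun j => ?_⟩
        have := h1 (Fin.succ_pos j)
        omega
      · intro uv _
        simp
      · intro uv h
        simp only [mem_filter, mem_bracketFinset, Prod.mk.injEq] at h
        obtain ⟨⟨h1, h2, h3, h4⟩, ⟨h5, h6⟩, h7, h8⟩ := h
        have h9 : uv.1 0 = u + 1 := by have := h2 0; omega
        rw [h9] at h7
        have h10 := Nat.eq_of_mul_eq_mul_left u.succ_pos h7
        ext j
        · exact Fin.cases (by simp [h9]) (by simp) j
        · exact Fin.cases (by simp [h10]) (by simp) j
      · intro uv _
        rw [Fin.prod_univ_succ]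
        simp
    · rw [zero_mul]
      symm
      refine sum_eq_zero fun uv h => absurd ?_ hc
      simp only [mem_filter, mem_bracketFinset, Prod.mk.injEq] at h
      obtain ⟨⟨h1, h2, h3, h4⟩, ⟨h5, h6⟩, h7, h8⟩ := h
      have h9 : uv.1 0 = u + 1 := by have := h2 0; omega
      rw [← h7, h9]
      exact ⟨dvd_mul_right _ _, Nat.mul_pos u.succ_pos (h3 0)⟩

/-- The limit of a sequence of series whose coefficients of `q ^ n` stabilise from `n` on. -/
noncomputable def diagLimit : (ℕ → PowerSeries ℚ) →ₗ[ℚ] PowerSeries ℚ where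
  toFun f := PowerSeries.mk fun n => coeff n (f n)
  map_add' f g := by ext; simp
  map_smul' c f := by ext; simp

theorem coeff_diagLimit (f : ℕ → PowerSeries ℚ) (n : ℕ) :
    coeff n (diagLimit f) = coeff n (f n) := by
  simp [diagLimit]

theorem diagLimit_mul {f g : ℕ → PowerSeries ℚ}
    (hf : ∀ n N, n ≤ N → coeff n (f N) = coeff n (f n))
    (hg : ∀ n N, n ≤ N → coeff n (g N) = coeff n (g n)) :
    diagLimit (f * g) = diagLimit f * diagLimit g := by
  ext n
  rw [coeff_diagLimit, Pi.mul_apply, coeff_mul, coeff_mul]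
  refine sum_congr rfl fun ij h => ?_
  rw [HasAntidiagonal.mem_antidiagonal] at h
  rw [coeff_diagLimit, coeff_diagLimit, hf ij.1 n (by omega), hg ij.2 n (by omega)]

theorem diagLimit_theta (f : ℕ → PowerSeries ℚ) :
    diagLimit (fun N => theta (f N)) = theta (diagLimit f) := by
  ext n
  rw [coeff_diagLimit, coeff_theta, coeff_theta, coeff_diagLimit]

theorem coeff_nestedSum_of_le (G : ℕ → ℕ → ℕ → ℚ) {m : ℕ} (p : Fin m → ℕ) {N n : ℕ} (h : n ≤ N) :
    coeff n (nestedSum (fun i => letter (G i)) (List.ofFn p) N) =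
      ∑ uv ∈ bracketFinset m n, ∏ j, G (p j) (uv.1 j) (uv.2 j) := by
  rw [coeff_nestedSum, filter_true_of_mem]
  intro uv huv j
  exact (bracketIndex_le (mem_bracketFinset.1 huv) j).1.trans h

theorem coeff_nestedSum_stable (G : ℕ → ℕ → ℕ → ℚ) (w : List ℕ) (n N : ℕ) (h : n ≤ N) :
    coeff n (nestedSum (fun i => letter (G i)) w N) =
      coeff n (nestedSum (fun i => letter (G i)) w n) := by
  rw [← List.ofFn_get w, coeff_nestedSum_of_le G _ h, coeff_nestedSum_of_le G _ le_rfl]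

/-- The series with coefficients `∑ F (u, v)` over the index tuples. -/
noncomputable def indexSeries (m : ℕ) :
    ((Fin m → ℕ) × (Fin m → ℕ) → ℚ) →ₗ[ℚ] PowerSeries ℚ where
  toFun F := PowerSeries.mk fun n => ∑ uv ∈ bracketFinset m n, F uv
  map_add' f g := by ext; simp [sum_add_distrib]
  map_smul' c f := by ext; simp [mul_sum]

theorem indexSeries_congr {m : ℕ} {F H : (Fin m → ℕ) × (Fin m → ℕ) → ℚ}
    (h : ∀ n, ∀ uv ∈ bracketFinset m n, F uv = H uv) : indexSeries m F = indexSeries m H := by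
  ext n
  simpa [indexSeries] using sum_congr rfl (h n)

theorem indexSeries_conjugate {m : ℕ} (F : (Fin m → ℕ) × (Fin m → ℕ) → ℚ) :
    indexSeries m (fun uv => F (conjugate uv)) = indexSeries m F := by
  ext n
  simpa [indexSeries] using sum_conjugate F

theorem diagLimit_nestedSum (G : ℕ → ℕ → ℕ → ℚ) {m : ℕ} (p : Fin m → ℕ) :
    diagLimit (nestedSum (fun i => letter (G i)) (List.ofFn p)) =
      indexSeries m fun uv => ∏ j, G (p j) (uv.1 j) (uv.2 j) := by
  ext n
  rw [coeff_diagLimit, coeff_nestedSum_of_le G p le_rfl]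
  simp [indexSeries]

theorem diagLimit_partLetter {m : ℕ} (p : Fin m → ℕ) :
    diagLimit (nestedSum partLetter (List.ofFn p)) =
      indexSeries m fun uv => ∏ j, (uv.2 j : ℚ) ^ p j :=
  diagLimit_nestedSum (fun i _ v => (v : ℚ) ^ i) p

theorem diagLimit_conjLetter {m : ℕ} (p : Fin m → ℕ) :
    diagLimit (nestedSum conjLetter (List.ofFn p)) =
      indexSeries m fun uv => ∏ j, (uv.1 j : ℚ) ^ p j :=
  diagLimit_nestedSum (fun i u _ => (u : ℚ) ^ i) p

/-- The span of the limits of nested sums of bounded weight and length. -/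
noncomputable def limitSpan (a : ℕ → ℕ → PowerSeries ℚ) (k l : ℕ) : Submodule ℚ (PowerSeries ℚ) :=
  (nestedSpan a k l).map diagLimit

theorem indexSeries_snd_mem {m D k l : ℕ} {f : (Fin m → ℕ) → ℚ} (hf : f ∈ polyFun m D)
    (hk : D + m ≤ k) (hl : m ≤ l) :
    indexSeries m (fun uv => f uv.2) ∈ limitSpan partLetter k l := by
  suffices h : polyFun m D ≤ (limitSpan partLetter k l).comap
      (indexSeries m ∘ₗ LinearMap.funLeft ℚ ℚ Prod.snd) from h hf
  refine Submodule.span_le.2 ?_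
  rintro _ ⟨p, hp, rfl⟩
  exact ⟨_, nestedSum_mem _ (List.ofFn p) (by simpa using hl)
    (by rw [List.sum_ofFn, List.length_ofFn]; omega), diagLimit_partLetter p⟩

theorem indexSeries_fst_mem {m D k l : ℕ} {f : (Fin m → ℕ) → ℚ} (hf : f ∈ polyFun m D)
    (hk : D + m ≤ k) (hl : m ≤ l) :
    indexSeries m (fun uv => f uv.1) ∈ limitSpan conjLetter k l := by
  suffices h : polyFun m D ≤ (limitSpan conjLetter k l).comap
      (indexSeries m ∘ₗ LinearMap.funLeft ℚ ℚ Prod.fst) from h hf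
  refine Submodule.span_le.2 ?_
  rintro _ ⟨p, hp, rfl⟩
  exact ⟨_, nestedSum_mem _ (List.ofFn p) (by simpa using hl)
    (by rw [List.sum_ofFn, List.length_ofFn]; omega), diagLimit_conjLetter p⟩

theorem limitSpan_le_of_nestedSum {a : ℕ → ℕ → PowerSeries ℚ} {k l : ℕ}
    {S : Submodule ℚ (PowerSeries ℚ)}
    (h : ∀ (m : ℕ) (p : Fin m → ℕ), m ≤ l → ∑ j, p j + m ≤ k →
      diagLimit (nestedSum a (List.ofFn p)) ∈ S) : limitSpan a k l ≤ S := by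
  rw [limitSpan, Submodule.map_le_iff_le_comap]
  refine Submodule.span_le.2 ?_
  rintro _ ⟨w, hl, hk, rfl⟩
  have := h w.length w.get hl (by rwa [← List.sum_ofFn, List.ofFn_get])
  rwa [List.ofFn_get] at this

theorem limitSpan_conjLetter (k l : ℕ) : limitSpan conjLetter k l = limitSpan partLetter k l := by
  refine le_antisymm (limitSpan_le_of_nestedSum fun m p hl hk => ?_)
    (limitSpan_le_of_nestedSum fun m p hl hk => ?_)
  · have h := prod_pow_mem_polyFun (fun j : Fin m => partialSum_mem_polyFun (m := m) (m - j)) p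
    rw [diagLimit_conjLetter, ← indexSeries_conjugate]
    convert indexSeries_snd_mem h hk hl using 2
    ext uv
    simp [conjugate]
  · have h := prod_pow_mem_polyFun (fun j : Fin m => sub_mem
      (zeroReverse_mem_polyFun (m := m) (j + 1)) (zeroReverse_mem_polyFun (m := m) j)) p
    rw [diagLimit_partLetter, ← indexSeries_conjugate]
    convert indexSeries_fst_mem h hk hl using 1
    refine indexSeries_congr fun n uv huv => ?_
    rw [mem_bracketFinset] at huv
    rw [prod_apply]
    refine prod_congr rfl fun j _ => ?_
    simp only [conjugate, Pi.pow_apply, Pi.sub_apply]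
    rw [Nat.cast_sub (zeroReverse_lt huv.1 huv.2.1 j.2).le]

theorem diagLimit_one_eq :
    diagLimit (nestedSum conjLetter [1]) = diagLimit (nestedSum partLetter [1]) := by
  have h1 := diagLimit_conjLetter fun _ : Fin 1 => 1
  have h2 := diagLimit_partLetter fun _ : Fin 1 => 1
  simp only [List.ofFn_succ, List.ofFn_zero] at h1 h2
  rw [h1, h2, ← indexSeries_conjugate]
  congr 1

theorem theta_mem {k l : ℕ} {f : PowerSeries ℚ} (hf : f ∈ limitSpan partLetter k l) :
    theta f ∈ limitSpan partLetter (k + 2) (l + 1) := by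
  have hmul : f * diagLimit (nestedSum partLetter [1]) ∈ limitSpan partLetter (k + 2) (l + 1) := by
    suffices h : limitSpan partLetter k l ≤ (limitSpan partLetter (k + 2) (l + 1)).comap
        (LinearMap.mulRight ℚ (diagLimit (nestedSum partLetter [1]))) from h hf
    refine limitSpan_le_of_nestedSum fun m p hl hk => ?_
    rw [Submodule.mem_comap, LinearMap.mulRight_apply, ← diagLimit_mul
      (f := nestedSum partLetter (List.ofFn p)) (g := nestedSum partLetter [1])
      (coeff_nestedSum_stable (fun i _ v => (v : ℚ) ^ i) _)
      (coeff_nestedSum_stable (fun i _ v => (v : ℚ) ^ i) _)]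
    refine ⟨_, nestedSpan_mono _ ?_ ?_ (nestedSum_mul_one_mem _), rfl⟩
    · rw [List.sum_ofFn, List.length_ofFn]; omega
    · rw [List.length_ofFn]; omega
  have hsub : theta f - f * diagLimit (nestedSum partLetter [1]) ∈
      limitSpan partLetter (k + 2) (l + 1) := by
    suffices h : limitSpan partLetter k l ≤ (limitSpan partLetter (k + 2) (l + 1)).comap
        ((theta : PowerSeries ℚ →ₗ[ℚ] PowerSeries ℚ) -
          LinearMap.mulRight ℚ (diagLimit (nestedSum partLetter [1]))) from h hf
    rw [← limitSpan_conjLetter, ← limitSpan_conjLetter]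
    refine limitSpan_le_of_nestedSum fun m p hl hk => ?_
    rw [Submodule.mem_comap, LinearMap.sub_apply, LinearMap.mulRight_apply, ← diagLimit_one_eq,
      ← diagLimit_mul
      (f := nestedSum conjLetter (List.ofFn p)) (g := nestedSum conjLetter [1])
      (coeff_nestedSum_stable (fun i u _ => (u : ℚ) ^ i) _)
      (coeff_nestedSum_stable (fun i u _ => (u : ℚ) ^ i) _)]
    refine ⟨_, nestedSpan_mono _ ?_ ?_ (theta_nestedSum_sub_mem (List.ofFn p)), ?_⟩
    · rw [List.sum_ofFn, List.length_ofFn]; omega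
    · rw [List.length_ofFn]; omega
    · rw [map_sub, diagLimit_theta]
      rfl
  simpa using add_mem hsub hmul

theorem iterate_theta_mem {k l : ℕ} {f : PowerSeries ℚ} (hf : f ∈ limitSpan partLetter k l)
    (i : ℕ) : (⇑theta)^[i] f ∈ limitSpan partLetter (k + 2 * i) (l + i) := by
  induction i with
  | zero => exact hf
  | succ i ih =>
    rw [Function.iterate_succ_apply']
    exact theta_mem ih

theorem biBracket_eq_indexSeries (l : ℕ) (s r : Fin l → ℕ) :
    biBracket l s r = indexSeries l fun uv =>
      ∏ j, ((uv.1 j : ℚ) ^ r j / (r j)!) * ((uv.2 j : ℚ) ^ (s j - 1) / ((s j - 1)!)) := by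
  ext n
  rw [biBracket, indexSeries, coeff_mk]
  exact (finsum_mem_eq_finite_toFinset_sum _ (bracketIndex_finite l n)).trans (by simp; rfl)

theorem coeff_iterate_theta (f : PowerSeries ℚ) (i n : ℕ) :
    coeff n ((⇑theta)^[i] f) = (n : ℚ) ^ i * coeff n f := by
  induction i with
  | zero => simp
  | succ i ih => rw [Function.iterate_succ_apply', coeff_theta, ih]; ring

theorem iterate_theta_indexSeries_one (F : (Fin 1 → ℕ) × (Fin 1 → ℕ) → ℚ) (i : ℕ) :
    (⇑theta)^[i] (indexSeries 1 F) =
      indexSeries 1 fun uv => ((uv.1 0 : ℚ) * uv.2 0) ^ i * F uv := by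
  ext n
  rw [coeff_iterate_theta]
  simp only [indexSeries, LinearMap.coe_mk, AddHom.coe_mk, coeff_mk, mul_sum]
  refine sum_congr rfl fun uv h => ?_
  rw [mem_bracketFinset] at h
  rw [← h.2.2.2]
  simp

theorem indexSeries_one_mem (s r : ℕ) :
    indexSeries 1 (fun uv => (uv.1 0 : ℚ) ^ r * (uv.2 0 : ℚ) ^ s) ∈
      limitSpan partLetter (s + r + 1) (r + 1) := by
  have hcoord (p : ℕ) : (fun x : Fin 1 → ℕ => (x 0 : ℚ) ^ p) ∈ polyFun 1 p :=
    Submodule.subset_span ⟨fun _ => p, by simp, by simp⟩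
  rcases le_total r s with h | h
  · obtain ⟨d, rfl⟩ := Nat.exists_eq_add_of_le h
    have h1 := iterate_theta_mem (indexSeries_snd_mem (hcoord d) le_rfl le_rfl) r
    rw [iterate_theta_indexSeries_one] at h1
    convert h1 using 2
    · omega
    · omega
    · ext uv; ring
  · obtain ⟨d, rfl⟩ := Nat.exists_eq_add_of_le h
    have h0 := indexSeries_fst_mem (hcoord d) le_rfl (show 1 ≤ d + 1 by omega)
    rw [limitSpan_conjLetter] at h0
    have h1 := iterate_theta_mem h0 s
    rw [iterate_theta_indexSeries_one] at h1
    convert h1 using 2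
    · omega
    · omega
    · ext uv; ring

/-- In length one, the bi-bracket `[s; r]` lies in the ℚ-span of `1` together with the
brackets `[t₁,…,t_m]` with `1 ≤ m ≤ r+1`, all `tⱼ ≥ 1` and `t₁ + … + t_m ≤ s + r`. -/
theorem biBracket_length_one_in_MD (s r : ℕ) (hs : 1 ≤ s) :
    biBracket 1 ![s] ![r] ∈
      Submodule.span ℚ ({(1 : PowerSeries ℚ)} ∪
        {f | ∃ (m : ℕ) (t : Fin m → ℕ), 1 ≤ m ∧ m ≤ r + 1 ∧ (∀ j, 1 ≤ t j) ∧
          (∑ j, t j) ≤ s + r ∧ f = biBracket m t fun _ => 0}) := by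
  have hle : limitSpan partLetter (s + r) (r + 1) ≤
      Submodule.span ℚ ({(1 : PowerSeries ℚ)} ∪
        {f | ∃ (m : ℕ) (t : Fin m → ℕ), 1 ≤ m ∧ m ≤ r + 1 ∧ (∀ j, 1 ≤ t j) ∧
          (∑ j, t j) ≤ s + r ∧ f = biBracket m t fun _ => 0}) := by
    refine limitSpan_le_of_nestedSum fun m p hl hk => ?_
    rcases Nat.eq_zero_or_pos m with rfl | hm
    · refine Submodule.subset_span (Or.inl ?_)
      ext n
      rw [coeff_diagLimit, List.ofFn_zero, nestedSum]
    · have : diagLimit (nestedSum partLetter (List.ofFn p)) =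
          (∏ j, ((p j)! : ℚ)) • biBracket m (fun j => p j + 1) fun _ => 0 := by
        rw [diagLimit_partLetter, biBracket_eq_indexSeries, ← map_smul]
        congr 1
        ext uv
        rw [Pi.smul_apply, smul_eq_mul, ← prod_mul_distrib]
        refine prod_congr rfl fun j _ => ?_
        have : ((p j)! : ℚ) ≠ 0 := Nat.cast_ne_zero.2 (Nat.factorial_ne_zero _)
        simp only [pow_zero, Nat.factorial_zero, Nat.cast_one, div_one, one_mul,
          Nat.add_sub_cancel]
        field_simp
      rw [this]
      refine Submodule.smul_mem _ _ (Submodule.subset_span (Or.inr ⟨m, _, hm, hl, ?_, ?_, rfl⟩))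
      · simp
      · simpa [sum_add_distrib] using hk
  refine hle ?_
  have h := indexSeries_one_mem (s - 1) r
  rw [show s - 1 + r + 1 = s + r by omega] at h
  convert Submodule.smul_mem _ ((r ! : ℚ)⁻¹ * ((s - 1)! : ℚ)⁻¹) h using 1
  rw [biBracket_eq_indexSeries, ← map_smul]
  congr 1
  ext uv
  simp only [univ_unique, Fin.default_eq_zero, Fin.isValue, prod_singleton,
    Matrix.cons_val_zero, Pi.smul_apply, smul_eq_mul]
  ring
end
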